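/- Fix ξ̄ ∈ Ω and, with the conventions ξ₀ = −∞, ξ_{n+1} = +∞, set x_i = ξ_{i+1}/a_i and y_i = ξ_i/a_i, and define β_i^- = (κ_i(u_{i+1}−u_i) F'(y_i)/(F(x_i)−F(y_i))) · (−y_i/2 − (F'(x_i)−F'(y_i))/(F(x_i)−F(y_i))) for i = 1,…,n and β_i^+ = (κ_i(u_{i+1}−u_i) F'(x_i)/(F(x_i)−F(y_i))) · (x_i/2 + (F'(x_i)−F'(y_i))/(F(x_i)−F(y_i))) for i = 0,…,n−1. Then β_i^- > 0 and β_i^+ > 0 for all admissible i, and moreover for every i = 1,…,n one has β_i^- + β_{i−1}^+ > (1/4) min(κ_i(u_{i+1}−u_i), κ_{i−1}(u_i−u_{i−1})). -/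

import Mathlib

open Real Filter Finset

/-- The rescaled Gaussian cumulative distribution function
`F(ξ) = (1/(2√π)) ∫_{-∞}^{ξ} e^{-s²/4} ds`. -/
noncomputable def F (x : ℝ) : ℝ :=
  (1 / (2 * Real.sqrt Real.pi)) * ∫ s in Set.Iio x, Real.exp (-s ^ 2 / 4)

/-- The derivative `F'(ξ) = (1/(2√π)) e^{-ξ²/4}`. -/
noncomputable def F' (x : ℝ) : ℝ :=
  (1 / (2 * Real.sqrt Real.pi)) * Real.exp (-x ^ 2 / 4)

/-- `β_i^- = (κ_i(u_{i+1}−u_i) F'(y_i)/(F(x_i)−F(y_i))) (−y_i/2 − (F'(x_i)−F'(y_i))/(F(x_i)−F(y_i)))`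
for `i = 1,…,n`, where `x_i = ξ_{i+1}/a_i`, `y_i = ξ_i/a_i`, with the convention `x_n = +∞`
(so `F(x_n) = 1`, `F'(x_n) = 0`). -/
noncomputable def betaMinus (n : ℕ) (u a k : ℕ → ℝ) (ξ : ℕ → ℝ) (i : ℕ) : ℝ :=
  k i / a i ^ 2 * (u (i + 1) - u i) * F' (ξ i / a i) /
      ((if i = n then 1 else F (ξ (i + 1) / a i)) - F (ξ i / a i)) *
    (-(ξ i / a i) / 2 -
      ((if i = n then 0 else F' (ξ (i + 1) / a i)) - F' (ξ i / a i)) /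
        ((if i = n then 1 else F (ξ (i + 1) / a i)) - F (ξ i / a i)))

/-- `β_i^+ = (κ_i(u_{i+1}−u_i) F'(x_i)/(F(x_i)−F(y_i))) (x_i/2 + (F'(x_i)−F'(y_i))/(F(x_i)−F(y_i)))`
for `i = 0,…,n−1`, where `x_i = ξ_{i+1}/a_i`, `y_i = ξ_i/a_i`, with the convention `y_0 = −∞`
(so `F(y_0) = 0`, `F'(y_0) = 0`). -/
noncomputable def betaPlus (u a k : ℕ → ℝ) (ξ : ℕ → ℝ) (i : ℕ) : ℝ :=
  k i / a i ^ 2 * (u (i + 1) - u i) * F' (ξ (i + 1) / a i) /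
      (F (ξ (i + 1) / a i) - (if i = 0 then 0 else F (ξ i / a i))) *
    ((ξ (i + 1) / a i) / 2 +
      (F' (ξ (i + 1) / a i) - (if i = 0 then 0 else F' (ξ i / a i))) /
        (F (ξ (i + 1) / a i) - (if i = 0 then 0 else F (ξ i / a i))))

lemma integrable_exp_neg_sq_div_four : MeasureTheory.Integrable fun s : ℝ => exp (-s ^ 2 / 4) := by
  refine (integrable_exp_neg_mul_sq (b := 1 / 4) (by norm_num)).congr (.of_forall fun s => ?_)
  ring_nf

lemma integral_exp_neg_sq_div_four : ∫ s : ℝ, exp (-s ^ 2 / 4) = 2 * √π := by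
  have h := integral_gaussian (1 / 4)
  rw [show π / (1 / 4) = 2 ^ 2 * π by ring, sqrt_mul (by norm_num),
    sqrt_sq (by norm_num)] at h
  rw [← h]
  congr 1
  ext s
  ring_nf

lemma F'_pos (x : ℝ) : 0 < F' x := by
  unfold F'
  positivity

lemma F'_neg (x : ℝ) : F' (-x) = F' x := by
  simp [F']

lemma F'_lt_F' {y x : ℝ} (hy : 0 ≤ y) (hyx : y < x) : F' x < F' y := by
  unfold F'
  have h : -x ^ 2 / 4 < -y ^ 2 / 4 := by nlinarith
  gcongr

lemma hasDerivAt_F (x : ℝ) : HasDerivAt F (F' x) x := by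
  have hF : F = fun x => F 0 + (1 / (2 * √π)) * ∫ s in (0 : ℝ)..x, exp (-s ^ 2 / 4) := by
    ext x
    have h := intervalIntegral.integral_Iic_sub_Iic
      (integrable_exp_neg_sq_div_four.integrableOn (s := Set.Iic 0))
      (integrable_exp_neg_sq_div_four.integrableOn (s := Set.Iic x))
    rw [← h]
    simp only [F, MeasureTheory.integral_Iic_eq_integral_Iio]
    ring
  rw [hF]
  have hc : Continuous fun s : ℝ => exp (-s ^ 2 / 4) := by fun_prop
  exact ((hc.integral_hasStrictDerivAt 0 x).hasDerivAt.const_mul _).const_add _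

lemma hasDerivAt_F' (x : ℝ) : HasDerivAt F' (-x / 2 * F' x) x := by
  have h : HasDerivAt (fun x : ℝ => -x ^ 2 / 4) (-(2 * x) / 4) x := by
    simpa using ((hasDerivAt_pow 2 x).neg.div_const 4)
  refine (h.exp.const_mul (1 / (2 * √π))).congr_deriv ?_
  unfold F'
  ring

lemma strictMono_F : StrictMono F :=
  strictMono_of_hasDerivAt_pos hasDerivAt_F F'_pos

lemma F_neg (x : ℝ) : F (-x) = 1 - F x := by
  have h1 : ∫ s in Set.Iio (-x), exp (-s ^ 2 / 4) = ∫ s in Set.Ioi x, exp (-s ^ 2 / 4) := by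
    have h := integral_comp_neg_Iic (-x) fun s : ℝ => exp (-s ^ 2 / 4)
    simpa [MeasureTheory.integral_Iic_eq_integral_Iio] using h
  have h2 := intervalIntegral.integral_Iic_add_Ioi
    (integrable_exp_neg_sq_div_four.integrableOn (s := Set.Iic x))
    (integrable_exp_neg_sq_div_four.integrableOn (s := Set.Ioi x))
  rw [integral_exp_neg_sq_div_four, MeasureTheory.integral_Iic_eq_integral_Iio] at h2
  unfold F
  rw [h1, eq_sub_iff_add_eq', ← mul_add, h2, one_div_mul_cancel (by positivity)]

lemma tendsto_F_atTop : Tendsto F atTop (nhds 1) := by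
  have h := (MeasureTheory.aecover_Iio (μ := MeasureTheory.volume)
    (tendsto_id (α := ℝ) (x := atTop))).integral_tendsto_of_countably_generated
    integrable_exp_neg_sq_div_four
  rw [integral_exp_neg_sq_div_four] at h
  have h' := h.const_mul (1 / (2 * √π))
  rwa [one_div_mul_cancel (by positivity)] at h'

lemma tendsto_F'_atTop : Tendsto F' atTop (nhds 0) := by
  have h : Tendsto (fun x : ℝ => -x ^ 2 / 4) atTop atBot := by
    simp only [neg_div, tendsto_neg_atBot_iff]
    exact (tendsto_pow_atTop (α := ℝ) two_ne_zero).atTop_div_const (by norm_num)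
  have h' := (tendsto_exp_atBot.comp h).const_mul (1 / (2 * √π))
  rwa [mul_zero] at h'

/-- The truncated first moment `∫_y^x (s - y)/2 F'(s) ds`, in closed form. -/
noncomputable def truncatedMoment (y x : ℝ) : ℝ := -y / 2 * (F x - F y) - (F' x - F' y)

lemma hasDerivAt_truncatedMoment (y x : ℝ) :
    HasDerivAt (truncatedMoment y) ((x - y) / 2 * F' x) x := by
  refine ((((hasDerivAt_F x).sub_const (F y)).const_mul (-y / 2)).sub
    ((hasDerivAt_F' x).sub_const (F' y))).congr_deriv ?_
  ring

lemma truncatedMoment_self (y : ℝ) : truncatedMoment y y = 0 := by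
  simp [truncatedMoment]

lemma strictMonoOn_Ici_of_hasDerivAt_pos {f f' : ℝ → ℝ} {y : ℝ}
    (hf : ∀ x, HasDerivAt f (f' x) x) (hf' : ∀ x, y < x → 0 < f' x) :
    StrictMonoOn f (Set.Ici y) := by
  refine strictMonoOn_of_deriv_pos (convex_Ici y)
    (fun x _ => (hf x).continuousAt.continuousWithinAt) fun x hx => ?_
  rw [(hf x).deriv]
  exact hf' x (by simpa using hx)

lemma strictMonoOn_truncatedMoment (y : ℝ) :
    StrictMonoOn (truncatedMoment y) (Set.Ici y) :=
  strictMonoOn_Ici_of_hasDerivAt_pos (hasDerivAt_truncatedMoment y) fun x hx =>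
    mul_pos (by linarith) (F'_pos x)

lemma F_sub_F_lt {y x : ℝ} (hy : 0 ≤ y) (hyx : y < x) : F x - F y < F' y * (x - y) := by
  have h := strictMonoOn_Ici_of_hasDerivAt_pos (y := y)
    (f := fun x => F' y * x - F x) (f' := fun x => F' y * 1 - F' x)
    (fun x => ((hasDerivAt_id x).const_mul (F' y)).sub (hasDerivAt_F x))
    (fun x hx => by linarith [F'_lt_F' hy hx]) Set.self_mem_Ici hyx.le hyx
  simp only at h
  linarith

lemma strictMonoOn_truncatedMoment_sub_sq {y : ℝ} (hy : 0 ≤ y) :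
    StrictMonoOn (fun x => F' y * truncatedMoment y x - (F x - F y) ^ 2 / 4) (Set.Ici y) := by
  refine strictMonoOn_Ici_of_hasDerivAt_pos
    (f' := fun x => F' x * ((F' y * (x - y) - (F x - F y)) / 2)) (fun x => ?_) fun x hx => ?_
  · refine (((hasDerivAt_truncatedMoment y x).const_mul (F' y)).sub
      ((((hasDerivAt_F x).sub_const (F y)).pow 2).div_const 4)).congr_deriv ?_
    ring
  · exact mul_pos (F'_pos x) (by linarith [F_sub_F_lt hy hx])

lemma StrictMonoOn.lt_of_tendsto_atTop {f : ℝ → ℝ} {y l : ℝ} (hf : StrictMonoOn f (Set.Ici y))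
    (hl : Tendsto f atTop (nhds l)) : f y < l := by
  have h1 : y ≤ y + 1 := by linarith
  refine (hf Set.self_mem_Ici h1 (by linarith : y < y + 1)).trans_le
    (ge_of_tendsto hl ((eventually_ge_atTop (y + 1)).mono fun x hx => ?_))
  exact hf.monotoneOn h1 (h1.trans hx) hx

/-- `p = F x` and `q = F' x` for some `x ∈ (y, +∞]`. -/
def IsRightEndpoint (y p q : ℝ) : Prop :=
  (∃ x, y < x ∧ p = F x ∧ q = F' x) ∨ (p = 1 ∧ q = 0)

lemma tendsto_truncatedMoment_atTop (y : ℝ) :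
    Tendsto (truncatedMoment y) atTop (nhds (-y / 2 * (1 - F y) - (0 - F' y))) :=
  ((tendsto_F_atTop.sub_const (F y)).const_mul _).sub (tendsto_F'_atTop.sub_const (F' y))

lemma IsRightEndpoint.sub_pos {y p q : ℝ} (h : IsRightEndpoint y p q) : 0 < p - F y := by
  obtain ⟨x, hx, rfl, rfl⟩ | ⟨rfl, rfl⟩ := h
  · exact _root_.sub_pos.2 (strictMono_F hx)
  · exact _root_.sub_pos.2 ((strictMono_F.strictMonoOn _).lt_of_tendsto_atTop tendsto_F_atTop)

lemma IsRightEndpoint.moment_pos {y p q : ℝ} (h : IsRightEndpoint y p q) :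
    0 < -y / 2 * (p - F y) - (q - F' y) := by
  have hm := strictMonoOn_truncatedMoment y
  rw [← truncatedMoment_self y]
  obtain ⟨x, hx, rfl, rfl⟩ | ⟨rfl, rfl⟩ := h
  · exact hm Set.self_mem_Ici hx.le hx
  · exact hm.lt_of_tendsto_atTop (tendsto_truncatedMoment_atTop y)

lemma IsRightEndpoint.sq_lt {y p q : ℝ} (h : IsRightEndpoint y p q) (hy : 0 ≤ y) :
    (p - F y) ^ 2 / 4 < F' y * (-y / 2 * (p - F y) - (q - F' y)) := by
  have hm := strictMonoOn_truncatedMoment_sub_sq hy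
  rw [← _root_.sub_pos]
  have h0 : F' y * truncatedMoment y y - (F y - F y) ^ 2 / 4 = 0 := by
    simp [truncatedMoment_self]
  rw [← h0]
  obtain ⟨x, hx, rfl, rfl⟩ | ⟨rfl, rfl⟩ := h
  · exact hm Set.self_mem_Ici hx.le hx
  · exact hm.lt_of_tendsto_atTop (((tendsto_truncatedMoment_atTop y).const_mul _).sub
      (((tendsto_F_atTop.sub_const (F y)).pow 2).div_const 4))

lemma IsRightEndpoint.beta_eq {y p q : ℝ} (h : IsRightEndpoint y p q) (c : ℝ) :
    c * F' y / (p - F y) * (-y / 2 - (q - F' y) / (p - F y)) =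
      c * (F' y * (-y / 2 * (p - F y) - (q - F' y)) / (p - F y) ^ 2) := by
  have := h.sub_pos.ne'
  field_simp

lemma IsRightEndpoint.beta_pos {y p q c : ℝ} (h : IsRightEndpoint y p q) (hc : 0 < c) :
    0 < c * F' y / (p - F y) * (-y / 2 - (q - F' y) / (p - F y)) := by
  rw [h.beta_eq]
  exact mul_pos hc (div_pos (mul_pos (F'_pos y) h.moment_pos) (pow_pos h.sub_pos 2))

lemma IsRightEndpoint.lt_beta {y p q c : ℝ} (h : IsRightEndpoint y p q) (hc : 0 < c)
    (hy : 0 ≤ y) :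
    1 / 4 * c < c * F' y / (p - F y) * (-y / 2 - (q - F' y) / (p - F y)) := by
  rw [h.beta_eq, mul_comm]
  refine mul_lt_mul_of_pos_left ?_ hc
  rw [lt_div_iff₀ (pow_pos h.sub_pos 2)]
  linarith [h.sq_lt hy]

lemma exists_betaMinus_eq {n i : ℕ} (u : ℕ → ℝ) {a : ℕ → ℝ} (k : ℕ → ℝ) {ξ : ℕ → ℝ}
    (ha : 0 < a i) (hξ : i ≠ n → ξ i < ξ (i + 1)) :
    ∃ p q, IsRightEndpoint (ξ i / a i) p q ∧ betaMinus n u a k ξ i =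
      k i / a i ^ 2 * (u (i + 1) - u i) * F' (ξ i / a i) / (p - F (ξ i / a i)) *
        (-(ξ i / a i) / 2 - (q - F' (ξ i / a i)) / (p - F (ξ i / a i))) := by
  refine ⟨_, _, ?_, rfl⟩
  by_cases hi : i = n
  · exact Or.inr ⟨if_pos hi, if_pos hi⟩
  · exact Or.inl ⟨_, div_lt_div_of_pos_right (hξ hi) ha, if_neg hi, if_neg hi⟩

/-- The reflection `s ↦ -s` turns `β⁺` into an expression of the form of `β⁻`. -/
lemma exists_betaPlus_eq {i : ℕ} (u : ℕ → ℝ) {a : ℕ → ℝ} (k : ℕ → ℝ) {ξ : ℕ → ℝ}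
    (ha : 0 < a i) (hξ : i ≠ 0 → ξ i < ξ (i + 1)) :
    ∃ p q, IsRightEndpoint (-(ξ (i + 1) / a i)) p q ∧ betaPlus u a k ξ i =
      k i / a i ^ 2 * (u (i + 1) - u i) * F' (-(ξ (i + 1) / a i)) /
        (p - F (-(ξ (i + 1) / a i))) *
        (-(-(ξ (i + 1) / a i)) / 2 -
          (q - F' (-(ξ (i + 1) / a i))) / (p - F (-(ξ (i + 1) / a i)))) := by
  refine ⟨1 - (if i = 0 then 0 else F (ξ i / a i)), if i = 0 then 0 else F' (ξ i / a i), ?_, ?_⟩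
  · by_cases hi : i = 0
    · exact Or.inr (by simp [hi])
    · refine Or.inl ⟨-(ξ i / a i), neg_lt_neg (div_lt_div_of_pos_right (hξ hi) ha), ?_, ?_⟩
      · rw [if_neg hi, F_neg]
      · rw [if_neg hi, F'_neg]
  · rw [F_neg, F'_neg, sub_sub_sub_cancel_left]
    unfold betaPlus
    ring

/-- For `ξ̄ ∈ Ω`: all `β_i^- > 0`, all `β_i^+ > 0`, and
`β_i^- + β_{i−1}^+ > (1/4) min(κ_i(u_{i+1}−u_i), κ_{i−1}(u_i−u_{i−1}))` for `i = 1,…,n`. -/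
theorem stmt13 (n : ℕ) (hn : 1 ≤ n) (u a k : ℕ → ℝ)
    (hu : ∀ i ≤ n, u i < u (i + 1))
    (ha : ∀ i ≤ n, 0 < a i)
    (hk : ∀ i ≤ n, 0 < k i)
    (ξ : ℕ → ℝ) (hξ : ∀ i, 1 ≤ i → i < n → ξ i < ξ (i + 1)) :
    (∀ i, 1 ≤ i → i ≤ n → 0 < betaMinus n u a k ξ i) ∧
    (∀ i, i < n → 0 < betaPlus u a k ξ i) ∧
    (∀ i, 1 ≤ i → i ≤ n →
      (1 / 4) * min (k i / a i ^ 2 * (u (i + 1) - u i))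
          (k (i - 1) / a (i - 1) ^ 2 * (u i - u (i - 1))) <
        betaMinus n u a k ξ i + betaPlus u a k ξ (i - 1)) := by
  have hc : ∀ i ≤ n, 0 < k i / a i ^ 2 * (u (i + 1) - u i) := fun i hi =>
    mul_pos (div_pos (hk i hi) (pow_pos (ha i hi) 2)) (sub_pos.2 (hu i hi))
  have hminus : ∀ i, 1 ≤ i → i ≤ n → 0 < betaMinus n u a k ξ i ∧
      (0 ≤ ξ i → 1 / 4 * (k i / a i ^ 2 * (u (i + 1) - u i)) < betaMinus n u a k ξ i) := by
    intro i h1 hi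
    obtain ⟨p, q, h, heq⟩ := exists_betaMinus_eq (n := n) u k (ha i hi)
      fun hne => hξ i h1 (lt_of_le_of_ne hi hne)
    rw [heq]
    exact ⟨h.beta_pos (hc i hi), fun h0 => h.lt_beta (hc i hi) (div_nonneg h0 (ha i hi).le)⟩
  have hplus : ∀ i, i < n → 0 < betaPlus u a k ξ i ∧
      (ξ (i + 1) ≤ 0 → 1 / 4 * (k i / a i ^ 2 * (u (i + 1) - u i)) < betaPlus u a k ξ i) := by
    intro i hi
    obtain ⟨p, q, h, heq⟩ := exists_betaPlus_eq u k (ha i hi.le)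
      fun hne => hξ i (Nat.one_le_iff_ne_zero.2 hne) hi
    rw [heq]
    exact ⟨h.beta_pos (hc i hi.le), fun h0 => h.lt_beta (hc i hi.le)
      (neg_nonneg.2 (div_nonpos_of_nonpos_of_nonneg h0 (ha i hi.le).le))⟩
  refine ⟨fun i h1 hi => (hminus i h1 hi).1, fun i hi => (hplus i hi).1, fun i h1 hi => ?_⟩
  obtain ⟨j, rfl⟩ := Nat.exists_eq_add_of_le' h1
  obtain ⟨hm, hm'⟩ := hminus (j + 1) h1 hi
  obtain ⟨hp, hp'⟩ := hplus j hi
  rw [Nat.add_sub_cancel]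
  rcases le_total 0 (ξ (j + 1)) with h0 | h0
  · have := hm' h0
    have := min_le_left (k (j + 1) / a (j + 1) ^ 2 * (u (j + 1 + 1) - u (j + 1)))
      (k j / a j ^ 2 * (u (j + 1) - u j))
    linarith
  · have := hp' h0
    have := min_le_right (k (j + 1) / a (j + 1) ^ 2 * (u (j + 1 + 1) - u (j + 1)))
      (k j / a j ^ 2 * (u (j + 1) - u j))
    linarith
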